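/- Neighbourhood equivalence transfers to nearby coloured elements: Let K ≥ k ≥ j ≥ 0 be natural numbers and let (I,κ) be a K-sparse coloured interpretation. Let x₁, x₂ be coloured elements with x₁ ∼_k x₂. If y₁ and y₂ are coloured elements with κ(y₁) = κ(y₂), d_I(y₁, x₁) ≤ k − j, and d_I(y₂, x₂) ≤ k − j, then y₁ ∼_j y₂. -/

import Mathlib

/-- An interpretation with concept names `Cn` and role names `Rn`. -/
structure Interp (Cn Rn : Type) where
  α : Type
  A : Cn → Set α
  r : Rn → α → α → Prop

namespace Interp

variable {Cn Rn Γ : Type}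

/-- A homomorphism of interpretations. -/
def IsHom (I J : Interp Cn Rn) (h : I.α → J.α) : Prop :=
  (∀ (c : Cn) (a : I.α), a ∈ I.A c → h a ∈ J.A c) ∧
  (∀ (s : Rn) (a b : I.α), I.r s a b → J.r s (h a) (h b))

/-- Adjacency: related by some role in either direction. -/
def Adj (I : Interp Cn Rn) (x y : I.α) : Prop :=
  ∃ s, I.r s x y ∨ I.r s y x

/-- There is a walk of length `n` from `x` to `y` along adjacent elements. -/
def ChainLen (I : Interp Cn Rn) (n : ℕ) (x y : I.α) : Prop :=
  ∃ z : Fin (n + 1) → I.α, z 0 = x ∧ z (Fin.last n) = y ∧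
    ∀ i : Fin n, Adj I (z i.castSucc) (z i.succ)

/-- The distance between two elements, in `ℕ∞`. -/
noncomputable def dist (I : Interp Cn Rn) (x y : I.α) : ℕ∞ :=
  sInf ((fun n : ℕ => (n : ℕ∞)) '' {n | ChainLen I n x y})

/-- The `k`-neighbourhood of `x`. -/
def Nbhd (I : Interp Cn Rn) (k : ℕ) (x : I.α) : Set I.α :=
  {y | dist I x y ≤ (k : ℕ∞)}

/-- The induced subinterpretation on a subset of the domain. -/
abbrev restrict (I : Interp Cn Rn) (Δ : Set I.α) : Interp Cn Rn where
  α := Δ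
  A := fun c => {a | (a : I.α) ∈ I.A c}
  r := fun s a b => I.r s (a : I.α) (b : I.α)

lemma mem_nbhd_self (I : Interp Cn Rn) (k : ℕ) (x : I.α) : x ∈ Nbhd I k x := by
  have h0 : ChainLen I 0 x x := ⟨fun _ => x, rfl, rfl, fun i => i.elim0⟩
  have h1 : dist I x x ≤ ((0 : ℕ) : ℕ∞) := sInf_le ⟨0, h0, rfl⟩
  exact le_trans h1 (by exact_mod_cast Nat.zero_le k)

/-- Colour-preserving homomorphism between coloured interpretations. -/
def ColourHom (I J : Interp Cn Rn) (κ : I.α → Option Γ) (θ : J.α → Option Γ)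
    (h : I.α → J.α) : Prop :=
  IsHom I J h ∧ (∀ x, κ x = none ↔ θ (h x) = none) ∧
  (∀ x γ, κ x = some γ → θ (h x) = some γ)

/-- The `k`-neighbourhood equivalence on the domain of a coloured interpretation. -/
def NbhdEquiv (I : Interp Cn Rn) (κ : I.α → Option Γ) (k : ℕ) (x y : I.α) : Prop :=
  x = y ∨
  ((∃ γ, κ x = some γ ∧ κ y = some γ) ∧
   (∃ h : (I.restrict (Nbhd I k x)).α → (I.restrict (Nbhd I k y)).α,
      ColourHom (I.restrict (Nbhd I k x)) (I.restrict (Nbhd I k y))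
        (fun a => κ a.val) (fun a => κ a.val) h ∧
      (h ⟨x, mem_nbhd_self I k x⟩ : I.α) = y) ∧
   (∃ g : (I.restrict (Nbhd I k y)).α → (I.restrict (Nbhd I k x)).α,
      ColourHom (I.restrict (Nbhd I k y)) (I.restrict (Nbhd I k x))
        (fun a => κ a.val) (fun a => κ a.val) g ∧
      (g ⟨y, mem_nbhd_self I k y⟩ : I.α) = x))

/-- `(I, κ)` is `k`-sparse. -/
def Sparse (I : Interp Cn Rn) (κ : I.α → Option Γ) (k : ℕ) : Prop :=
  ∀ x y y' : I.α, y ∈ Nbhd I k x → y' ∈ Nbhd I k x →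
    (∃ γ, κ y = some γ) → (∃ γ', κ y' = some γ') → y ≠ y' → κ y ≠ κ y'

/-- The quotient of an interpretation by a relation on its domain. -/
def quot (I : Interp Cn Rn) (R : I.α → I.α → Prop) : Interp Cn Rn where
  α := Quot R
  A := fun c => {q | ∃ x, q = Quot.mk R x ∧ x ∈ I.A c}
  r := fun s p q => ∃ x y, p = Quot.mk R x ∧ q = Quot.mk R y ∧ I.r s x y

end Interp

namespace Interp

variable {Cn Rn Γ : Type}

lemma chainLen_succ {I : Interp Cn Rn} {n : ℕ} {x y : I.α} :
    ChainLen I (n + 1) x y ↔ ∃ w, ChainLen I n x w ∧ Adj I w y := by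
  constructor
  · rintro ⟨z, h0, hl, hz⟩
    refine ⟨z (Fin.last n).castSucc, ⟨fun i => z i.castSucc, h0, rfl, fun i => hz i.castSucc⟩, ?_⟩
    have h := hz (Fin.last n)
    rwa [Fin.succ_last, hl] at h
  · rintro ⟨w, ⟨z, h0, hl, hz⟩, hw⟩
    refine ⟨Fin.snoc (α := fun _ => I.α) z y, ?_, by simp, fun i => ?_⟩
    · rw [← Fin.castSucc_zero, Fin.snoc_castSucc, h0]
    · induction i using Fin.lastCases with
      | last => rw [Fin.snoc_castSucc, Fin.succ_last, Fin.snoc_last, hl]; exact hw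
      | cast i => rw [Fin.snoc_castSucc, Fin.succ_castSucc, Fin.snoc_castSucc]; exact hz i

lemma chainLen_zero {I : Interp Cn Rn} {x y : I.α} : ChainLen I 0 x y ↔ x = y :=
  ⟨fun ⟨_, h0, hl, _⟩ => h0.symm.trans hl, fun h => ⟨fun _ => x, rfl, h, fun i => i.elim0⟩⟩

lemma Adj.symm {I : Interp Cn Rn} {x y : I.α} (h : Adj I x y) : Adj I y x :=
  let ⟨s, hs⟩ := h
  ⟨s, hs.symm⟩

lemma ChainLen.symm {I : Interp Cn Rn} {n : ℕ} {x y : I.α} (h : ChainLen I n x y) :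
    ChainLen I n y x := by
  obtain ⟨z, h0, hl, hz⟩ := h
  refine ⟨fun i => z i.rev, by simpa using hl, by simpa using h0, fun i => ?_⟩
  simpa [Fin.rev_castSucc, Fin.rev_succ] using (hz i.rev).symm

lemma ChainLen.trans {I : Interp Cn Rn} {m n : ℕ} {x y z : I.α} (h : ChainLen I m x y)
    (h' : ChainLen I n y z) : ChainLen I (m + n) x z := by
  induction n generalizing z with
  | zero => rwa [← chainLen_zero.1 h']
  | succ n ih =>
    obtain ⟨w, hw, hwz⟩ := chainLen_succ.1 h'
    exact chainLen_succ.2 ⟨w, ih hw, hwz⟩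

lemma mem_nbhd_iff {I : Interp Cn Rn} {k : ℕ} {x y : I.α} :
    y ∈ Nbhd I k x ↔ ∃ n ≤ k, ChainLen I n x y := by
  constructor
  · intro h
    have hne : ((fun n : ℕ => (n : ℕ∞)) '' {n | ChainLen I n x y}).Nonempty := by
      by_contra hne
      rw [Set.not_nonempty_iff_eq_empty] at hne
      have h' : sInf ((fun n : ℕ => (n : ℕ∞)) '' {n | ChainLen I n x y}) ≤ (k : ℕ∞) := h
      rw [hne, sInf_empty] at h'
      exact absurd h' (by simp)
    obtain ⟨n, hn, hnd⟩ := csInf_mem hne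
    have h' : (n : ℕ∞) ≤ (k : ℕ∞) := hnd.le.trans h
    exact ⟨n, by exact_mod_cast h', hn⟩
  · rintro ⟨n, hnk, hn⟩
    have h : dist I x y ≤ (n : ℕ∞) := sInf_le ⟨n, hn, rfl⟩
    exact h.trans (by exact_mod_cast hnk)

lemma nbhd_symm {I : Interp Cn Rn} {k : ℕ} {x y : I.α} (h : y ∈ Nbhd I k x) :
    x ∈ Nbhd I k y :=
  let ⟨n, hnk, hn⟩ := mem_nbhd_iff.1 h
  mem_nbhd_iff.2 ⟨n, hnk, hn.symm⟩

lemma nbhd_trans {I : Interp Cn Rn} {m n k : ℕ} {x y z : I.α} (hy : y ∈ Nbhd I m x)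
    (hz : z ∈ Nbhd I n y) (hk : m + n ≤ k) : z ∈ Nbhd I k x :=
  let ⟨_, ha, ha'⟩ := mem_nbhd_iff.1 hy
  let ⟨_, hb, hb'⟩ := mem_nbhd_iff.1 hz
  mem_nbhd_iff.2 ⟨_, (add_le_add ha hb).trans hk, ha'.trans hb'⟩

lemma nbhd_mono {I : Interp Cn Rn} {m k : ℕ} {x : I.α} (h : m ≤ k) :
    Nbhd I m x ⊆ Nbhd I k x :=
  fun y hy => nbhd_trans hy (mem_nbhd_self I 0 y) h

lemma Sparse.eq_of_mem_nbhd {I : Interp Cn Rn} {κ : I.α → Option Γ} {k : ℕ}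
    (hs : Sparse I κ k) {x y y' : I.α} (hy : y ∈ Nbhd I k x) (hy' : y' ∈ Nbhd I k x) {γ : Γ}
    (hc : κ y = some γ) (hc' : κ y' = some γ) : y = y' := by
  by_contra hne
  exact hs x y y' hy hy' ⟨γ, hc⟩ ⟨γ, hc'⟩ hne (hc.trans hc'.symm)

/-- A homomorphism between induced subinterpretations maps a chain to a chain of the same length
provided the ball of that radius around the starting point lies in the domain. -/
lemma ChainLen.map {I : Interp Cn Rn} {Δ Δ' : Set I.α} {h : Δ → Δ'}
    (hh : IsHom (I.restrict Δ) (I.restrict Δ') h) {n : ℕ} {y z : I.α} (hc : ChainLen I n y z)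
    (hsub : Nbhd I n y ⊆ Δ) (hy : y ∈ Δ) (hz : z ∈ Δ) :
    ChainLen I n (h ⟨y, hy⟩ : I.α) (h ⟨z, hz⟩ : I.α) := by
  induction n generalizing z with
  | zero =>
    obtain rfl := chainLen_zero.1 hc
    exact chainLen_zero.2 rfl
  | succ n ih =>
    obtain ⟨w, hw, s, hs⟩ := chainLen_succ.1 hc
    have hwΔ : w ∈ Δ := hsub (mem_nbhd_iff.2 ⟨n, n.le_succ, hw⟩)
    refine chainLen_succ.2
      ⟨_, ih hw ((nbhd_mono n.le_succ).trans hsub) hwΔ, s, ?_⟩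
    exact hs.imp (hh.2 s ⟨w, hwΔ⟩ ⟨z, hz⟩) (hh.2 s ⟨z, hz⟩ ⟨w, hwΔ⟩)

lemma mem_nbhd_map {I : Interp Cn Rn} {Δ Δ' : Set I.α} {h : Δ → Δ'}
    (hh : IsHom (I.restrict Δ) (I.restrict Δ') h) {n : ℕ} {y z : I.α} (hc : z ∈ Nbhd I n y)
    (hsub : Nbhd I n y ⊆ Δ) (hy : y ∈ Δ) (hz : z ∈ Δ) :
    (h ⟨z, hz⟩ : I.α) ∈ Nbhd I n (h ⟨y, hy⟩ : I.α) :=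
  let ⟨_, hmn, hm⟩ := mem_nbhd_iff.1 hc
  mem_nbhd_iff.2 ⟨_, hmn, hm.map hh ((nbhd_mono hmn).trans hsub) hy hz⟩

/-- In a sparse interpretation, a colour-preserving homomorphism between neighbourhoods
restricts to one between smaller neighbourhoods of nearby elements of the same colour. -/
lemma exists_colourHom_of_mem_nbhd {I : Interp Cn Rn} {κ : I.α → Option Γ} {K k j : ℕ}
    (hKk : k ≤ K) (hkj : j ≤ k) (hs : Sparse I κ K) {x₁ x₂ y₁ y₂ : I.α} {γ : Γ}
    (hy₁ : κ y₁ = some γ) (hy₂ : κ y₂ = some γ)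
    (hd₁ : y₁ ∈ Nbhd I (k - j) x₁) (hd₂ : y₂ ∈ Nbhd I (k - j) x₂)
    {h : Nbhd I k x₁ → Nbhd I k x₂}
    (hh : ColourHom (I.restrict (Nbhd I k x₁)) (I.restrict (Nbhd I k x₂))
      (fun a => κ a.val) (fun a => κ a.val) h) :
    ∃ g : (I.restrict (Nbhd I j y₁)).α → (I.restrict (Nbhd I j y₂)).α,
      ColourHom (I.restrict (Nbhd I j y₁)) (I.restrict (Nbhd I j y₂))
        (fun a => κ a.val) (fun a => κ a.val) g ∧
      (g ⟨y₁, mem_nbhd_self I j y₁⟩ : I.α) = y₂ := by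
  have hkjk : k - j ≤ k := Nat.sub_le k j
  have hsub : Nbhd I j y₁ ⊆ Nbhd I k x₁ := fun z hz => nbhd_trans hd₁ hz (by omega)
  have hy : y₁ ∈ Nbhd I k x₁ := nbhd_mono hkjk hd₁
  have hhy : (h ⟨y₁, hy⟩ : I.α) = y₂ :=
    hs.eq_of_mem_nbhd (nbhd_mono hKk (h ⟨y₁, hy⟩).2) (nbhd_mono (hkjk.trans hKk) hd₂)
      (hh.2.2 ⟨y₁, hy⟩ γ hy₁) hy₂
  refine ⟨fun z => ⟨h ⟨z.1, hsub z.2⟩, ?_⟩, ⟨⟨?_, ?_⟩, ?_, ?_⟩, hhy⟩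
  · have hz := mem_nbhd_map hh.1 z.2 hsub hy (hsub z.2)
    rwa [hhy] at hz
  · exact fun c a => hh.1.1 c ⟨a.1, hsub a.2⟩
  · exact fun s a b => hh.1.2 s ⟨a.1, hsub a.2⟩ ⟨b.1, hsub b.2⟩
  · exact fun a => hh.2.1 ⟨a.1, hsub a.2⟩
  · exact fun a => hh.2.2 ⟨a.1, hsub a.2⟩

end Interp

open Interp in
/-- Neighbourhood equivalence transfers to nearby coloured elements: for `K ≥ k ≥ j`,
a `K`-sparse coloured interpretation, coloured `x₁ ∼_k x₂`, and equally-coloured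
`y₁`, `y₂` at distance at most `k − j` from `x₁`, `x₂` respectively, we get `y₁ ∼_j y₂`. -/
theorem nbhdEquiv_transfer {Cn Rn Γ : Type} (K k j : ℕ) (hKk : K ≥ k) (hkj : k ≥ j)
    (I : Interp Cn Rn) (κ : I.α → Option Γ) (hsparse : Sparse I κ K)
    (x₁ x₂ : I.α) (hx₁ : ∃ γ, κ x₁ = some γ) (hx₂ : ∃ γ, κ x₂ = some γ)
    (hx : NbhdEquiv I κ k x₁ x₂)
    (y₁ y₂ : I.α) (γ : Γ) (hy₁ : κ y₁ = some γ) (hy₂ : κ y₂ = some γ)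
    (hd₁ : dist I y₁ x₁ ≤ ((k - j : ℕ) : ℕ∞))
    (hd₂ : dist I y₂ x₂ ≤ ((k - j : ℕ) : ℕ∞)) :
    NbhdEquiv I κ j y₁ y₂ := by
  have hd₁ : y₁ ∈ Nbhd I (k - j) x₁ := nbhd_symm hd₁
  have hd₂ : y₂ ∈ Nbhd I (k - j) x₂ := nbhd_symm hd₂
  rcases hx with rfl | ⟨-, ⟨h, hh, -⟩, ⟨g, hg, -⟩⟩
  · have hle : k - j ≤ K := (Nat.sub_le k j).trans hKk
    exact Or.inl (hsparse.eq_of_mem_nbhd (nbhd_mono hle hd₁) (nbhd_mono hle hd₂) hy₁ hy₂)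
  · exact Or.inr ⟨⟨γ, hy₁, hy₂⟩,
      exists_colourHom_of_mem_nbhd hKk hkj hsparse hy₁ hy₂ hd₁ hd₂ hh,
      exists_colourHom_of_mem_nbhd hKk hkj hsparse hy₂ hy₁ hd₂ hd₁ hg⟩
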